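/- If A ⊆ ℕ is a Δ⁰₂ set that is 1-random (Martin-Löf random), then every infinite subset of A and every infinite subset of the complement of A computes a diagonally noncomputable function, i.e., a function g : ℕ → ℕ such that g(e) ≠ Φ_e(e) for every e for which Φ_e(e) converges. -/

import Mathlib

/-!
Preamble: oracle computability, Turing reducibility, the jump, martingales,
and Martin-Löf randomness, developed from scratch.
-/

open scoped Classical

/-- The characteristic function of a set of naturals. -/
noncomputable def chi (A : Set ℕ) : ℕ → ℕ :=
  fun n => if n ∈ A then 1 else 0

/-- Partial functions recursive in a (total) oracle `O : ℕ → ℕ`.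
This mirrors `Nat.Partrec`, with an additional constructor for the oracle. -/
inductive RecIn (O : ℕ → ℕ) : (ℕ →. ℕ) → Prop
  | oracle : RecIn O (fun n => Part.some (O n))
  | zero : RecIn O (fun _ => Part.some 0)
  | succ : RecIn O (fun n => Part.some (n + 1))
  | left : RecIn O (fun n => Part.some (Nat.unpair n).1)
  | right : RecIn O (fun n => Part.some (Nat.unpair n).2)
  | pair {f g} : RecIn O f → RecIn O g → RecIn O (fun n => Nat.pair <$> f n <*> g n)
  | comp {f g} : RecIn O f → RecIn O g → RecIn O (fun n => g n >>= f)
  | prec {f g} :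
      RecIn O f → RecIn O g →
      RecIn O
        (Nat.unpaired fun a n =>
          n.rec (f a) fun y IH => do
            let i ← IH
            g (Nat.pair a (Nat.pair y i)))
  | rfind {f} :
      RecIn O f →
      RecIn O (fun a => Nat.rfind fun n => (fun m => m = 0) <$> f (Nat.pair a n))

/-- Codes for oracle machines. -/
inductive OCode : Type
  | zero : OCode
  | succ : OCode
  | left : OCode
  | right : OCode
  | oracle : OCode
  | pair : OCode → OCode → OCode
  | comp : OCode → OCode → OCode
  | prec : OCode → OCode → OCode
  | rfind' : OCode → OCode

/-- Evaluation of oracle codes relative to a total oracle. -/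
def evalo (O : ℕ → ℕ) : OCode → ℕ →. ℕ
  | .zero => fun _ => Part.some 0
  | .succ => fun n => Part.some (n + 1)
  | .left => fun n => Part.some (Nat.unpair n).1
  | .right => fun n => Part.some (Nat.unpair n).2
  | .oracle => fun n => Part.some (O n)
  | .pair cf cg => fun n => Nat.pair <$> evalo O cf n <*> evalo O cg n
  | .comp cf cg => fun n => evalo O cg n >>= evalo O cf
  | .prec cf cg =>
      Nat.unpaired fun a n =>
        n.rec (evalo O cf a) fun y IH => do
          let i ← IH
          evalo O cg (Nat.pair a (Nat.pair y i))
  | .rfind' cf =>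
      Nat.unpaired fun a m =>
        (Nat.rfind fun n => (fun x => x = 0) <$> evalo O cf (Nat.pair a (n + m))).map (· + m)

/-- A surjective listing of oracle codes. -/
def ofNatOCode : ℕ → OCode
  | 0 => .zero
  | 1 => .succ
  | 2 => .left
  | 3 => .right
  | 4 => .oracle
  | n + 5 =>
    have hm : n.div2.div2 < n + 5 := by
      rw [Nat.div2_val, Nat.div2_val]
      exact lt_of_le_of_lt (le_trans (Nat.div_le_self _ _) (Nat.div_le_self _ _))
        (Nat.lt_succ_of_le (Nat.le_add_right _ 4))
    have _m1 : n.div2.div2.unpair.1 < n + 5 :=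
      lt_of_le_of_lt (Nat.unpair_left_le _) hm
    have _m2 : n.div2.div2.unpair.2 < n + 5 :=
      lt_of_le_of_lt (Nat.unpair_right_le _) hm
    match n.bodd, n.div2.bodd with
    | false, false => .pair (ofNatOCode n.div2.div2.unpair.1) (ofNatOCode n.div2.div2.unpair.2)
    | false, true  => .comp (ofNatOCode n.div2.div2.unpair.1) (ofNatOCode n.div2.div2.unpair.2)
    | true , false => .prec (ofNatOCode n.div2.div2.unpair.1) (ofNatOCode n.div2.div2.unpair.2)
    | true , true  => .rfind' (ofNatOCode n.div2.div2)

/-- `Phi O e` is the `e`-th partial `O`-computable function `Φ_e^O`. -/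
def Phi (O : ℕ → ℕ) (e : ℕ) : ℕ →. ℕ := evalo O (ofNatOCode e)

/-- The Turing jump `A'` of a set `A`. -/
noncomputable def jump (A : Set ℕ) : Set ℕ := {e | (Phi (chi A) e e).Dom}

/-- The halting set `∅'`. -/
noncomputable def K : Set ℕ := jump ∅

/-- Turing reducibility between sets: `TRed B A` means `B ≤_T A`. -/
noncomputable def TRed (B A : Set ℕ) : Prop :=
  RecIn (chi A) (fun n => Part.some (chi B n))

/-- The effective join of two sets. -/
def join (A B : Set ℕ) : Set ℕ :=
  {n | (∃ a ∈ A, n = 2 * a) ∨ (∃ b ∈ B, n = 2 * b + 1)}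

/-- A set is low if its jump is Turing reducible to `∅'`. -/
noncomputable def Low (L : Set ℕ) : Prop := TRed (jump L) K

/-- The function `f : α → β` presented as an oracle on `ℕ`, via the encodings. -/
def fnOracle {α β : Type} [Encodable α] [Encodable β] (f : α → β) : ℕ → ℕ :=
  fun n => Encodable.encode ((Encodable.decode (α := α) n).map f)

/-- `FRed f A` means the function `f` is Turing reducible to the set `A`. -/
noncomputable def FRed {α β : Type} [Encodable α] [Encodable β] (f : α → β) (A : Set ℕ) : Prop :=
  RecIn (chi A) (fun n => Part.some (fnOracle f n))

/-- `FFRed g f` means the function `g` is Turing reducible to the function `f`. -/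
def FFRed {α β γ δ : Type} [Encodable α] [Encodable β] [Encodable γ] [Encodable δ]
    (g : γ → δ) (f : α → β) : Prop :=
  RecIn (fnOracle f) (fun n => Part.some (fnOracle g n))

/-- A martingale: a nonnegative rational-valued function on finite binary strings
satisfying the averaging condition `2 M(σ) = M(σ0) + M(σ1)`. -/
def IsMartingale (M : List Bool → ℚ) : Prop :=
  (∀ σ, 0 ≤ M σ) ∧ ∀ σ, 2 * M σ = M (σ ++ [false]) + M (σ ++ [true])

/-- The length-`n` initial segment of the characteristic sequence of `A`. -/
noncomputable def seg (A : Set ℕ) (n : ℕ) : List Bool :=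
  (List.range n).map fun i => if i ∈ A then true else false

/-- A martingale succeeds on a set `A` if `limsup_n M(A↾n) = ∞`. -/
noncomputable def Succeeds (M : List Bool → ℚ) (A : Set ℕ) : Prop :=
  ∀ q : ℚ, ∃ n, q < M (seg A n)

/-- `H(A)`: the mass problem of infinite subsets or cosubsets of `A`. -/
def Hset (A : Set ℕ) : Set (Set ℕ) :=
  {S | S.Infinite ∧ (S ⊆ A ∨ S ⊆ Aᶜ)}

/-- Muchnik reducibility: `MuchnikLe P Q` iff every member of `Q` computes a member of `P`. -/
noncomputable def MuchnikLe (P Q : Set (Set ℕ)) : Prop :=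
  ∀ B ∈ Q, ∃ A ∈ P, TRed A B

/-- A set of naturals is computably enumerable. -/
def CE (W : Set ℕ) : Prop :=
  ∃ g : ℕ →. ℕ, RecIn (fun _ => 0) g ∧ ∀ n, n ∈ W ↔ (g n).Dom

/-- A Martin-Löf test: a uniformly c.e. sequence of sets of strings `U n`,
with the open set generated by `U n` having measure at most `2^{-n}`. -/
def MLTest (U : ℕ → Set (List Bool)) : Prop :=
  CE {p : ℕ | ∃ σ ∈ U (Nat.unpair p).1, (Nat.unpair p).2 = Encodable.encode σ} ∧
  ∀ n, (∑' σ : (U n), ((1 : ENNReal) / 2) ^ (σ : List Bool).length) ≤ (1 / 2) ^ n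

/-- A set is 1-random (Martin-Löf random) if for every Martin-Löf test there is
an `n` such that no initial segment of the set lies in `U n`. -/
noncomputable def MLRandom (A : Set ℕ) : Prop :=
  ∀ U : ℕ → Set (List Bool), MLTest U → ∃ n, ∀ m, seg A m ∉ U n

theorem RecIn.of_partrec {O : ℕ → ℕ} {f : ℕ →. ℕ} (h : Nat.Partrec f) : RecIn O f := by
  induction h with
  | zero => exact RecIn.zero
  | succ => exact RecIn.succ
  | left => exact RecIn.left
  | right => exact RecIn.right
  | pair _ _ h1 h2 => exact RecIn.pair h1 h2
  | comp _ _ h1 h2 => exact RecIn.comp h1 h2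
  | prec _ _ h1 h2 => exact RecIn.prec h1 h2
  | rfind _ h1 => exact RecIn.rfind h1

theorem RecIn.of_eq {O : ℕ → ℕ} {f g : ℕ →. ℕ} (h : RecIn O g) (e : f = g) : RecIn O f := e ▸ h

theorem RecIn.of_prim {O : ℕ → ℕ} {f : ℕ → ℕ} (h : Primrec f) :
    RecIn O (fun n => Part.some (f n)) :=
  RecIn.of_partrec (Nat.Partrec.of_primrec (Primrec.nat_iff.1 h))

theorem RecIn.tcomp {O : ℕ → ℕ} {f g : ℕ → ℕ} (hf : RecIn O (fun n => Part.some (f n)))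
    (hg : RecIn O (fun n => Part.some (g n))) : RecIn O (fun n => Part.some (f (g n))) := by
  have := RecIn.comp hf hg
  simpa using this

theorem RecIn.tpair {O : ℕ → ℕ} {f g : ℕ → ℕ} (hf : RecIn O (fun n => Part.some (f n)))
    (hg : RecIn O (fun n => Part.some (g n))) :
    RecIn O (fun n => Part.some (Nat.pair (f n) (g n))) := by
  have := RecIn.pair hf hg
  simpa [Seq.seq] using this

theorem exS {S : Set ℕ} (hS : S.Infinite) (i : ℕ) : ∃ n, i + n ∈ S := by
  obtain ⟨m, hm, h⟩ := hS.exists_gt i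
  exact ⟨m - i, by rwa [Nat.add_sub_cancel' h.le]⟩

noncomputable def nxt {S : Set ℕ} (hS : S.Infinite) (i : ℕ) : ℕ := Nat.find (exS hS i)

noncomputable def FF {S : Set ℕ} (hS : S.Infinite) : ℕ → ℕ
  | 0 => 0
  | k + 1 => Nat.succ (Nat.pair (FF hS k + nxt hS (FF hS k)) (FF hS k))

theorem rec_nxt {S : Set ℕ} (hS : S.Infinite) :
    RecIn (chi S) (fun n => Part.some (nxt hS n)) := by
  have h1 : RecIn (chi S) (fun n => Part.some (1 - chi S (n.unpair.1 + n.unpair.2))) := by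
    refine RecIn.tcomp (f := fun n => 1 - n) (RecIn.of_prim ?_)
      (RecIn.tcomp RecIn.oracle (RecIn.of_prim ?_))
    · exact Primrec.nat_sub.comp (Primrec.const 1) Primrec.id
    · exact Primrec.nat_add.comp (Primrec.fst.comp Primrec.unpair)
        (Primrec.snd.comp Primrec.unpair)
  have h2 := RecIn.rfind h1
  refine RecIn.of_eq h2 ?_
  funext a
  symm
  rw [Part.eq_some_iff]
  refine Nat.mem_rfind.2 ?_
  have hsp := Nat.find_spec (exS hS a)
  constructor
  · simp only [Nat.unpair_pair, Part.map_eq_map, Part.map_some, Part.mem_some_iff]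
    simp [chi, nxt, hsp]
  · intro m hm
    have := Nat.find_min (exS hS a) hm
    simp only [Nat.unpair_pair, Part.map_eq_map, Part.map_some, Part.mem_some_iff]
    simp [chi, this]

theorem rec_FF {S : Set ℕ} (hS : S.Infinite) :
    RecIn (chi S) (fun n => Part.some (FF hS n)) := by
  have h1 : RecIn (chi S) (fun n => Part.some
      (Nat.succ (Nat.pair (n + nxt hS n) n))) := by
    have hid : RecIn (chi S) (fun n => Part.some n) := RecIn.of_prim Primrec.id
    refine RecIn.tcomp (f := Nat.succ) RecIn.succ (RecIn.tpair ?_ hid)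
    have := RecIn.tcomp (O := chi S) (f := fun n => n.unpair.1 + n.unpair.2)
      (RecIn.of_prim (Primrec.nat_add.comp (Primrec.fst.comp Primrec.unpair)
        (Primrec.snd.comp Primrec.unpair))) (RecIn.tpair hid (rec_nxt hS))
    simpa using this
  have h2 : RecIn (chi S) (fun n => Part.some
      (Nat.succ (Nat.pair (n.unpair.2.unpair.2 + nxt hS n.unpair.2.unpair.2)
        n.unpair.2.unpair.2))) :=
    RecIn.tcomp (g := fun n => n.unpair.2.unpair.2) h1 (RecIn.tcomp RecIn.right RecIn.right)
  have h3 := RecIn.prec RecIn.zero h2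
  have h4 := RecIn.comp h3 (RecIn.of_prim (f := fun n => Nat.pair 0 n)
    (Primrec₂.natPair.comp (Primrec.const 0) Primrec.id))
  refine RecIn.of_eq h4 ?_
  funext n
  simp only [Part.bind_eq_bind, Part.bind_some, Nat.unpaired, Nat.unpair_pair]
  induction n with
  | zero => simp [FF]
  | succ k ih => simp only [← ih, Part.bind_some, FF]

/-- the finite set (as a list) coded by a number -/
def DD (v : ℕ) : List ℕ := (List.range v).filter fun x => x ∈ Denumerable.ofNat (List ℕ) v

theorem DD_nodup (v : ℕ) : (DD v).Nodup := List.nodup_range.filter _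

theorem DD_lt {v x : ℕ} (h : x ∈ DD v) : x < v := by
  simp [DD] at h; exact h.1

theorem ofNat_succ_pair (a c : ℕ) : Denumerable.ofNat (List ℕ) (Nat.succ (Nat.pair a c)) =
    a :: Denumerable.ofNat (List ℕ) c := by
  simp [Denumerable.list_ofNat_succ]

theorem FF_spec {S : Set ℕ} (hS : S.Infinite) (k : ℕ) :
    (Denumerable.ofNat (List ℕ) (FF hS k)).length = k ∧
    (Denumerable.ofNat (List ℕ) (FF hS k)).Nodup ∧
    ∀ x ∈ Denumerable.ofNat (List ℕ) (FF hS k), x ∈ S ∧ x < FF hS k := by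
  induction k with
  | zero => simp [FF]
  | succ k ih =>
    obtain ⟨h1, h2, h3⟩ := ih
    have ha := Nat.left_le_pair (FF hS k + nxt hS (FF hS k)) (FF hS k)
    have hb := Nat.right_le_pair (FF hS k + nxt hS (FF hS k)) (FF hS k)
    rw [FF, ofNat_succ_pair]
    refine ⟨by simp [h1], ?_, ?_⟩
    · rw [List.nodup_cons]
      refine ⟨fun h => ?_, h2⟩
      have := (h3 _ h).2
      omega
    · intro x hx
      rcases List.mem_cons.1 hx with rfl | hx
      · exact ⟨Nat.find_spec (exS hS (FF hS k)), by omega⟩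
      · have := h3 x hx
        exact ⟨this.1, by omega⟩

theorem DD_FF {S : Set ℕ} (hS : S.Infinite) (k : ℕ) :
    (DD (FF hS k)).length = k ∧ ∀ x ∈ DD (FF hS k), x ∈ S := by
  obtain ⟨h1, h2, h3⟩ := FF_spec hS k
  constructor
  · have : List.Perm (DD (FF hS k)) (Denumerable.ofNat (List ℕ) (FF hS k)) := by
      rw [List.perm_ext_iff_of_nodup (DD_nodup _) h2]
      intro a
      simp only [DD, List.mem_filter, List.mem_range, decide_eq_true_eq]
      exact ⟨fun h => h.2, fun h => ⟨(h3 a h).2, h⟩⟩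
    rw [this.length_eq, h1]
  · intro x hx
    simp only [DD, List.mem_filter, List.mem_range, decide_eq_true_eq] at hx
    exact (h3 x hx.2).1

theorem DD_prim : Primrec DD := by
  have h1 : PrimrecRel fun (x : ℕ) (l : List ℕ) => x ∈ l := by
    have := (PrimrecRel.exists_mem_list (Primrec.eq (α := ℕ)))
    exact PrimrecRel.of_eq (this.comp₂ Primrec₂.right Primrec₂.left) (by simp)
  have h2 := PrimrecRel.listFilter h1
  refine (h2.comp Primrec.list_range (Primrec.ofNat (List ℕ))).of_eq fun v => ?_
  simp [DD]

/-- translation of oracle codes -/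
def tr : OCode → Nat.Partrec.Code
  | .zero => .zero
  | .succ => .succ
  | .left => .left
  | .right => .right
  | .oracle => .zero
  | .pair a b => .pair (tr a) (tr b)
  | .comp a b => .comp (tr a) (tr b)
  | .prec a b => .prec (tr a) (tr b)
  | .rfind' a => .rfind' (tr a)

theorem tr_eval (c : OCode) : (tr c).eval = evalo (chi ∅) c := by
  induction c with
  | zero => rfl
  | succ => rfl
  | left => rfl
  | right => rfl
  | oracle => funext n; simp [tr, evalo, chi, Nat.Partrec.Code.eval]; rfl
  | pair a b h1 h2 => simp only [tr, evalo, Nat.Partrec.Code.eval, h1, h2]; rfl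
  | comp a b h1 h2 => simp only [tr, evalo, Nat.Partrec.Code.eval, h1, h2]; rfl
  | prec a b h1 h2 => simp only [tr, evalo, Nat.Partrec.Code.eval, h1, h2]; rfl
  | rfind' a h1 => simp only [tr, evalo, Nat.Partrec.Code.eval, h1]; rfl

open Nat.Partrec (Code)

def stepc (l : List Code) : Option Code :=
  let n := l.length
  let m := n - 5
  let k := m.div2.div2
  if n = 0 then some Code.zero else
  if n = 1 then some Code.succ else
  if n = 2 then some Code.left else
  if n = 3 then some Code.right else
  if n = 4 then some Code.zero else
  bif m.bodd then
    bif m.div2.bodd then (l[k]?).map Code.rfind'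
    else (l[k.unpair.1]?).bind fun a => (l[k.unpair.2]?).map fun b => Code.prec a b
  else
    bif m.div2.bodd then
      (l[k.unpair.1]?).bind fun a => (l[k.unpair.2]?).map fun b => Code.comp a b
    else (l[k.unpair.1]?).bind fun a => (l[k.unpair.2]?).map fun b => Code.pair a b

theorem stepc_prim : Primrec stepc := by
  have hn : Primrec (fun l : List Code => l.length) := Primrec.list_length
  have hm : Primrec (fun l : List Code => l.length - 5) :=
    Primrec.nat_sub.comp hn (Primrec.const 5)
  have hk : Primrec (fun l : List Code => (l.length - 5).div2.div2) :=
    Primrec.nat_div2.comp (Primrec.nat_div2.comp hm)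
  have h1 : Primrec (fun l : List Code => l[(l.length - 5).div2.div2.unpair.1]?) :=
    Primrec.list_getElem?.comp Primrec.id (Primrec.fst.comp (Primrec.unpair.comp hk))
  have h2 : Primrec (fun l : List Code => l[(l.length - 5).div2.div2.unpair.2]?) :=
    Primrec.list_getElem?.comp Primrec.id (Primrec.snd.comp (Primrec.unpair.comp hk))
  have h3 : Primrec (fun l : List Code => l[(l.length - 5).div2.div2]?) :=
    Primrec.list_getElem?.comp Primrec.id hk
  have hb : ∀ {f : Code → Code → Code}, Primrec₂ f → Primrec (fun l : List Code =>
      (l[(l.length - 5).div2.div2.unpair.1]?).bind fun a =>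
        (l[(l.length - 5).div2.div2.unpair.2]?).map fun b => f a b) := by
    intro f hf
    refine Primrec.option_bind h1 ?_
    refine Primrec.option_map (h2.comp Primrec.fst) ?_
    exact hf.comp₂ (Primrec.snd.comp₂ Primrec₂.left) Primrec₂.right
  have he : ∀ i : ℕ, PrimrecPred (fun l : List Code => l.length = i) := fun i =>
    Primrec.eq.comp hn (Primrec.const i)
  unfold stepc
  refine Primrec.ite (he 0) (Primrec.const _) ?_
  refine Primrec.ite (he 1) (Primrec.const _) ?_
  refine Primrec.ite (he 2) (Primrec.const _) ?_
  refine Primrec.ite (he 3) (Primrec.const _) ?_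
  refine Primrec.ite (he 4) (Primrec.const _) ?_
  refine Primrec.cond (Primrec.nat_bodd.comp hm) ?_ ?_
  · refine Primrec.cond (Primrec.nat_bodd.comp (Primrec.nat_div2.comp hm)) ?_ ?_
    · exact Primrec.option_map h3 (Code.primrec_rfind'.comp₂ Primrec₂.right)
    · exact hb Code.primrec₂_prec
  · refine Primrec.cond (Primrec.nat_bodd.comp (Primrec.nat_div2.comp hm)) ?_ ?_
    · exact hb Code.primrec₂_comp
    · exact hb Code.primrec₂_pair

theorem stepc_spec (n : ℕ) :
    stepc ((List.range n).map fun i => tr (ofNatOCode i)) = some (tr (ofNatOCode n)) := by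
  match n with
  | 0 => simp [stepc, ofNatOCode, tr]
  | 1 => simp [stepc, ofNatOCode, tr]
  | 2 => simp [stepc, ofNatOCode, tr]
  | 3 => simp [stepc, ofNatOCode, tr]
  | 4 => simp [stepc, ofNatOCode, tr]
  | n + 5 =>
    have hm : n.div2.div2 < n + 5 := by
      rw [Nat.div2_val, Nat.div2_val]; omega
    have m1 : n.div2.div2.unpair.1 < n + 5 := lt_of_le_of_lt (Nat.unpair_left_le _) hm
    have m2 : n.div2.div2.unpair.2 < n + 5 := lt_of_le_of_lt (Nat.unpair_right_le _) hm
    rw [ofNatOCode]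
    cases h1 : n.bodd <;> cases h2 : n.div2.bodd <;>
      simp [stepc, h1, h2, tr, hm, m1, m2]

theorem tr_prim : Primrec fun n => tr (ofNatOCode n) := by
  have : Primrec₂ (fun (_ : Unit) n => tr (ofNatOCode n)) :=
    Primrec.nat_strong_rec _ (g := fun _ l => stepc l) (stepc_prim.comp₂ Primrec₂.right)
      (fun _ n => stepc_spec n)
  exact this.comp (Primrec.const ()) Primrec.id

theorem phi_partrec : Partrec fun e : ℕ => Phi (chi ∅) e e := by
  have := Code.eval_part.comp tr_prim.to_comp Computable.id
  refine this.of_eq fun n => ?_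
  simp [tr_eval, Phi]

/-- Strings deciding the set coded by their length to be homogeneous of colour `b`. -/
def good (b : Bool) (σ : List Bool) : Prop := ∀ x ∈ DD σ.length, σ[x]? = some b

def TT (b : Bool) (n e : ℕ) : Set (List Bool) :=
  {σ | σ.length ∈ Phi (chi ∅) e e ∧ (DD σ.length).length = n + e + 1 ∧ good b σ}

def UU (b : Bool) (n : ℕ) : Set (List Bool) := ⋃ e, TT b n e

theorem good_prim (b : Bool) : PrimrecPred (good b) := by
  have h : PrimrecRel fun (x : ℕ) (σ : List Bool) => σ[x]? = some b :=
    Primrec.eq.comp (Primrec.list_getElem?.comp Primrec.snd Primrec.fst) (Primrec.const _)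
  exact h.forall_mem_list.comp (DD_prim.comp Primrec.list_length) Primrec.id

theorem UU_ce (b : Bool) :
    CE {p : ℕ | ∃ σ ∈ UU b (Nat.unpair p).1, (Nat.unpair p).2 = Encodable.encode σ} := by
  let sg : ℕ → List Bool := fun p => (Encodable.decode (α := List Bool) p.unpair.2).getD []
  let ee : ℕ → ℕ := fun p => (DD (sg p).length).length - (p.unpair.1 + 1)
  have hsg : Primrec sg := Primrec.option_getD.comp
    (Primrec.decode.comp (Primrec.snd.comp Primrec.unpair)) (Primrec.const [])
  have hlen : Primrec fun p => (DD (sg p).length).length :=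
    Primrec.list_length.comp (DD_prim.comp (Primrec.list_length.comp hsg))
  have hn : Primrec fun p : ℕ => p.unpair.1 := Primrec.fst.comp Primrec.unpair
  have hee : Primrec ee := Primrec.nat_sub.comp hlen (Primrec.succ.comp hn)
  let cnd : ℕ × ℕ → Prop := fun q => q.2 = (sg q.1).length ∧
    q.1.unpair.2 = Encodable.encode (sg q.1) ∧
    (DD (sg q.1).length).length = q.1.unpair.1 + ee q.1 + 1 ∧ good b (sg q.1)
  have hc : PrimrecPred cnd := by
    refine PrimrecPred.and ?_ (PrimrecPred.and ?_ (PrimrecPred.and ?_ ?_))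
    · exact Primrec.eq.comp Primrec.snd (Primrec.list_length.comp (hsg.comp Primrec.fst))
    · exact Primrec.eq.comp (Primrec.snd.comp (Primrec.unpair.comp Primrec.fst))
        (Primrec.encode.comp (hsg.comp Primrec.fst))
    · exact Primrec.eq.comp (hlen.comp Primrec.fst)
        (Primrec.succ.comp (Primrec.nat_add.comp (hn.comp Primrec.fst) (hee.comp Primrec.fst)))
    · exact (good_prim b).comp (hsg.comp Primrec.fst)
  have ho : Primrec (fun q : ℕ × ℕ => if cnd q then some 0 else (none : Option ℕ)) :=
    Primrec.ite hc (Primrec.const _) (Primrec.const _)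
  have hp : Partrec (fun p : ℕ => (Phi (chi ∅) (ee p) (ee p)).bind fun v =>
      ((if cnd (p, v) then some 0 else (none : Option ℕ) : Option ℕ) : Part ℕ)) :=
    Partrec.bind (phi_partrec.comp hee.to_comp) (Computable.ofOption ho.to_comp)
  refine ⟨_, RecIn.of_partrec (Partrec.nat_iff.1 hp), fun p => ?_⟩
  rw [Part.dom_iff_mem]
  simp only [Part.mem_bind_iff, Part.mem_ofOption, Set.mem_setOf_eq, UU, Set.mem_iUnion, TT]
  constructor
  · rintro ⟨σ, ⟨e, h1, h2, h3⟩, h4⟩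
    have e1 : sg p = σ := by simp [sg, h4]
    have e2 : ee p = e := by simp only [ee, e1, h2]; omega
    refine ⟨0, σ.length, by rwa [e2], ?_⟩
    have : cnd (p, σ.length) := ⟨by simp [e1], by simp [e1, h4], by simp [e1, e2, h2], by simpa [e1]⟩
    simp [this]
  · rintro ⟨y, v, h1, h2⟩
    have : cnd (p, v) := by
      by_contra h
      simp [h] at h2
    obtain ⟨c1, c2, c3, c4⟩ := this
    simp only at c1 c2 c3 c4
    exact ⟨sg p, ⟨ee p, by rwa [← c1], c3, c4⟩, c2⟩

theorem card_bound (b : Bool) (v : ℕ) :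
    ∑' σ : {σ : List Bool | σ.length = v ∧ good b σ}, ((1 : ENNReal) / 2) ^ (σ : List Bool).length
      ≤ (1 / 2) ^ (DD v).length := by
  set T := {σ : List Bool | σ.length = v ∧ good b σ} with hT
  have hfin : T.Finite := (List.finite_length_eq Bool v).subset fun σ h => h.1
  haveI : Fintype T := hfin.fintype
  let R := Finset.range v \ (DD v).toFinset
  have hR : R.card + (DD v).length = v := by
    have hs : (DD v).toFinset ⊆ Finset.range v := fun x hx => by
      simpa using DD_lt (List.mem_toFinset.1 hx)
    have := Finset.card_sdiff_add_card_eq_card hs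
    rwa [List.toFinset_card_of_nodup (DD_nodup v), Finset.card_range] at this
  have hcard : Fintype.card T ≤ 2 ^ R.card := by
    have : Function.Injective (fun (σ : T) (x : R) => (σ : List Bool)[(x : ℕ)]?.getD b) := by
      rintro ⟨σ, h1, h2⟩ ⟨τ, h3, h4⟩ h
      simp only [Subtype.mk.injEq]
      apply List.ext_getElem? 
      intro i
      by_cases hi : i < v
      · by_cases hd : i ∈ DD v
        · rw [h2 i (by rwa [h1]), h4 i (by rwa [h3])]
        · have := congrFun h ⟨i, by simp [R, hi, hd]⟩
          have a1 : i < σ.length := by omega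
          have a2 : i < τ.length := by omega
          simpa [a1, a2] using this
      · rw [List.getElem?_eq_none (by omega), List.getElem?_eq_none (by omega)]
    have := Fintype.card_le_of_injective _ this
    simpa using this
  rw [tsum_fintype]
  have : ∀ σ : T, ((1 : ENNReal) / 2) ^ (σ : List Bool).length = (1 / 2) ^ v := fun σ => by
    rw [σ.2.1]
  simp only [this, Finset.sum_const, Finset.card_univ, nsmul_eq_mul]
  calc ((Fintype.card T : ℕ) : ENNReal) * (1 / 2) ^ v
      ≤ ((2 ^ R.card : ℕ) : ENNReal) * (1 / 2) ^ v := by gcongr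
    _ = (1 / 2) ^ (DD v).length := by
      conv_lhs => rw [← hR, pow_add, ← mul_assoc]
      push_cast
      rw [← mul_pow, one_div, ENNReal.mul_inv_cancel (by simp) (by simp)]
      simp

theorem UU_meas (b : Bool) (n : ℕ) :
    (∑' σ : (UU b n), ((1 : ENNReal) / 2) ^ (σ : List Bool).length) ≤ (1 / 2) ^ n := by
  have hT : ∀ e, (∑' σ : (TT b n e), ((1 : ENNReal) / 2) ^ (σ : List Bool).length)
      ≤ (1 / 2) ^ (n + e + 1) := by
    intro e
    by_cases h : (TT b n e).Nonempty
    · obtain ⟨τ, h1, h2, h3⟩ := h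
      rw [← h2]
      refine le_trans ?_ (card_bound b τ.length)
      refine ENNReal.tsum_mono_subtype (fun σ : List Bool => ((1 : ENNReal) / 2) ^ σ.length) ?_
      intro σ hσ
      exact ⟨Part.mem_unique hσ.1 h1, hσ.2.2⟩
    · rw [Set.not_nonempty_iff_eq_empty] at h
      rw [h]; simp
  calc (∑' σ : (UU b n), ((1 : ENNReal) / 2) ^ (σ : List Bool).length)
      ≤ ∑' e, ∑' σ : (TT b n e), ((1 : ENNReal) / 2) ^ (σ : List Bool).length :=
        ENNReal.tsum_iUnion_le_tsum (fun σ : List Bool => ((1 : ENNReal) / 2) ^ σ.length) _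
    _ ≤ ∑' e : ℕ, (1 / 2) ^ (n + e + 1) := ENNReal.tsum_le_tsum hT
    _ = (1 / 2) ^ n := by
      have : ∀ e : ℕ, ((1 : ENNReal) / 2) ^ (n + e + 1) = (1 / 2) ^ n * 2⁻¹ ^ (e + 1) := by
        intro e; rw [add_assoc, pow_add]; simp
      simp only [this]
      rw [ENNReal.tsum_mul_left, ENNReal.tsum_geometric_add_one]
      simp [ENNReal.one_sub_inv_two, ENNReal.inv_mul_cancel]

theorem FRed_g {S : Set ℕ} (hS : S.Infinite) (n : ℕ) :
    FRed (fun e => FF hS (n + e + 1)) S := by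
  have h := RecIn.tcomp (f := Nat.succ) (O := chi S) RecIn.succ
    (RecIn.tcomp (rec_FF hS) (RecIn.of_prim (f := fun e => n + e + 1)
    (Primrec.succ.comp (Primrec.nat_add.comp (Primrec.const n) Primrec.id))))
  unfold FRed
  refine RecIn.of_eq h ?_
  funext k
  simp [fnOracle]

/-- every infinite subset or cosubset of a `Δ⁰₂` 1-random set computes
a diagonally noncomputable function. -/
theorem stmt13 (A : Set ℕ) (hA : TRed A K) (hrand : MLRandom A)
    (S : Set ℕ) (hS : S.Infinite) (hsub : S ⊆ A ∨ S ⊆ Aᶜ) :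
    ∃ g : ℕ → ℕ, FRed g S ∧ ∀ e, g e ∉ Phi (chi ∅) e e := by
  obtain ⟨b, hb⟩ : ∃ b : Bool, ∀ x ∈ S, (if x ∈ A then true else false) = b := by
    rcases hsub with h | h
    · exact ⟨true, fun x hx => by simp [h hx]⟩
    · exact ⟨false, fun x hx => by simpa using h hx⟩
  obtain ⟨n, hn⟩ := hrand (UU b) ⟨UU_ce b, UU_meas b⟩
  refine ⟨fun e => FF hS (n + e + 1), FRed_g hS n, fun e he => ?_⟩
  obtain ⟨h1, h2⟩ := DD_FF hS (n + e + 1)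
  apply hn (FF hS (n + e + 1))
  have hl : (seg A (FF hS (n + e + 1))).length = FF hS (n + e + 1) := by simp [seg]
  refine Set.mem_iUnion.2 ⟨e, by rwa [hl], by rwa [hl], ?_⟩
  intro x hx
  rw [hl] at hx
  have hlt := DD_lt hx
  have := hb x (h2 x hx)
  simp only [seg, List.getElem?_map, List.getElem?_range hlt, Option.map_some, this]
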